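/- Fix s₀ > 0 and for an integer n ≥ 1 set t_n = s₀(2^{2n} − 1). For an integer n ≥ 1, define the action S_n on integrable functions p : ℝ² → ℂ by (S_n[p])(x) = (G(·, t_n) ⋆ p)(2ⁿ x). Then for all integers m, n ≥ 1 and every integrable p : ℝ² → ℂ, S_m[S_n[p]] = S_{m+n}[p] as functions on ℝ² (the actions satisfy S_m ∘ S_n = S_{m+n}). -/

import Mathlib

open MeasureTheory

/-- The 2-D Gauss–Weierstrass kernel `G(x, t) = (4πt)⁻¹ exp(−‖x‖²/(4t))`. -/
noncomputable def gaussKernel (x : EuclideanSpace ℝ (Fin 2)) (t : ℝ) : ℝ :=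
  (4 * Real.pi * t)⁻¹ * Real.exp (-‖x‖ ^ 2 / (4 * t))

/-- Convolution `(g ⋆ p)(x) = ∫ g(y) p(x − y) dy` on `ℝ²`. -/
noncomputable def conv (g p : EuclideanSpace ℝ (Fin 2) → ℂ)
    (x : EuclideanSpace ℝ (Fin 2)) : ℂ :=
  ∫ y, g y * p (x - y)

/-- `t_n = s₀ (2^{2n} − 1)`. -/
noncomputable def tvar (s₀ : ℝ) (n : ℕ) : ℝ := s₀ * (2 ^ (2 * n) - 1)

/-- The action `(S_n[p])(x) = (G(·, t_n) ⋆ p)(2ⁿ x)`. -/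
noncomputable def jump (s₀ : ℝ) (n : ℕ) (p : EuclideanSpace ℝ (Fin 2) → ℂ)
    (x : EuclideanSpace ℝ (Fin 2)) : ℂ :=
  conv (fun y => (gaussKernel y (tvar s₀ n) : ℂ)) p ((2 ^ n : ℝ) • x)

theorem continuous_gaussKernel (t : ℝ) : Continuous fun x => gaussKernel x t := by
  unfold gaussKernel
  fun_prop

theorem norm_gaussKernel_le {t : ℝ} (ht : 0 < t) (x : EuclideanSpace ℝ (Fin 2)) :
    ‖(gaussKernel x t : ℂ)‖ ≤ (4 * Real.pi * t)⁻¹ := by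
  have hpos : 0 < (4 * Real.pi * t)⁻¹ := by positivity
  have hexp : Real.exp (-‖x‖ ^ 2 / (4 * t)) ≤ 1 :=
    Real.exp_le_one_iff.2 (div_nonpos_of_nonpos_of_nonneg (by simp) (by positivity))
  rw [Complex.norm_real, Real.norm_of_nonneg (by unfold gaussKernel; positivity)]
  exact mul_le_of_le_one_right hpos.le hexp

theorem integrable_gaussKernel {t : ℝ} (ht : 0 < t) :
    Integrable fun x : EuclideanSpace ℝ (Fin 2) => (gaussKernel x t : ℂ) := by
  have hb : 0 < ((4 * t)⁻¹ : ℂ).re := by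
    rw [← Complex.ofReal_ofNat, ← Complex.ofReal_mul, ← Complex.ofReal_inv, Complex.ofReal_re]
    positivity
  refine ((GaussianFourier.integrable_cexp_neg_mul_sq_norm_add hb 0
    (0 : EuclideanSpace ℝ (Fin 2))).const_mul ((4 * Real.pi * t)⁻¹ : ℂ)).congr
    (.of_forall fun x => ?_)
  simp only [gaussKernel]
  push_cast
  congr 2
  simp
  ring

/-- Convolving a Gauss–Weierstrass kernel with a dilated one adds the (rescaled) times. -/
theorem integral_gaussKernel_mul_gaussKernel {s t : ℝ} (hs : 0 < s) (ht : 0 < t) (a : ℝ)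
    (v : EuclideanSpace ℝ (Fin 2)) :
    ∫ y, (gaussKernel y s : ℂ) * (gaussKernel (v - a • y) t : ℂ) =
      (gaussKernel v (a ^ 2 * s + t) : ℂ) := by
  set r : ℝ := a ^ 2 * s + t with hr_def
  have hr : 0 < r := by positivity
  have hb : 0 < ((r / (4 * s * t) : ℝ) : ℂ).re := by
    rw [Complex.ofReal_re]; positivity
  have hs' : (s : ℂ) ≠ 0 := by exact_mod_cast hs.ne'
  have ht' : (t : ℂ) ≠ 0 := by exact_mod_cast ht.ne'
  have hr' : (r : ℂ) ≠ 0 := by exact_mod_cast hr.ne'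
  have hpi : (Real.pi : ℂ) ≠ 0 := by exact_mod_cast Real.pi_ne_zero
  have key : ∀ y : EuclideanSpace ℝ (Fin 2),
      (gaussKernel y s : ℂ) * (gaussKernel (v - a • y) t : ℂ) =
      ((4 * Real.pi * s)⁻¹ * (4 * Real.pi * t)⁻¹ * Complex.exp (-‖v‖ ^ 2 / (4 * t))) *
        Complex.exp (-((r / (4 * s * t) : ℝ) : ℂ) * ‖y‖ ^ 2 +
          ((a / (2 * t) : ℝ) : ℂ) * (inner ℝ v y : ℝ)) := by
    intro y
    have hexp : Real.exp (-‖y‖ ^ 2 / (4 * s)) * Real.exp (-‖v - a • y‖ ^ 2 / (4 * t)) =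
        Real.exp (-‖v‖ ^ 2 / (4 * t)) *
          Real.exp (-(r / (4 * s * t)) * ‖y‖ ^ 2 + a / (2 * t) * inner ℝ v y) := by
      rw [← Real.exp_add, ← Real.exp_add, norm_sub_sq_real, inner_smul_right, norm_smul, mul_pow,
        Real.norm_eq_abs, sq_abs, hr_def]
      congr 1
      field_simp
      ring
    simp only [gaussKernel]
    have := congrArg (fun z : ℝ => (4 * Real.pi * s)⁻¹ * (4 * Real.pi * t)⁻¹ * z) hexp
    have := congrArg (fun z : ℝ => (z : ℂ)) this
    push_cast at this ⊢
    linear_combination this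
  simp_rw [key]
  rw [integral_const_mul, GaussianFourier.integral_cexp_neg_mul_sq_norm_add hb]
  have hdim : (Module.finrank ℝ (EuclideanSpace ℝ (Fin 2)) / 2 : ℂ) = 1 := by simp
  have hexp : Complex.exp (-‖v‖ ^ 2 / (4 * t)) *
      Complex.exp (((a / (2 * t) : ℝ) : ℂ) ^ 2 * ‖v‖ ^ 2 / (4 * ((r / (4 * s * t) : ℝ) : ℂ))) =
      Complex.exp (-‖v‖ ^ 2 / (4 * r)) := by
    rw [← Complex.exp_add]
    congr 1
    push_cast
    field_simp
    rw [hr_def]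
    push_cast
    ring
  rw [hdim, Complex.cpow_one, gaussKernel]
  push_cast at hexp ⊢
  rw [← hexp]
  field_simp

theorem conv_eq_integral_sub (g p : EuclideanSpace ℝ (Fin 2) → ℂ)
    (x : EuclideanSpace ℝ (Fin 2)) : conv g p x = ∫ u, g (x - u) * p u := by
  rw [conv, ← integral_sub_left_eq_self _ volume x]
  simp

theorem tvar_pos {s₀ : ℝ} (hs₀ : 0 < s₀) {n : ℕ} (hn : 1 ≤ n) : 0 < tvar s₀ n :=
  mul_pos hs₀ (sub_pos.2 (one_lt_pow₀ one_lt_two (by omega)))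

theorem tvar_add (s₀ : ℝ) (m n : ℕ) :
    tvar s₀ (m + n) = (2 ^ n) ^ 2 * tvar s₀ m + tvar s₀ n := by
  unfold tvar
  ring

theorem jump_action_add (s₀ : ℝ) (hs₀ : 0 < s₀) (m n : ℕ) (hm : 1 ≤ m) (hn : 1 ≤ n)
    (p : EuclideanSpace ℝ (Fin 2) → ℂ) (hp : Integrable p) :
    jump s₀ m (jump s₀ n p) = jump s₀ (m + n) p := by
  funext x
  have hs := tvar_pos hs₀ hm
  have ht := tvar_pos hs₀ hn
  have hpoint : ∀ y u : EuclideanSpace ℝ (Fin 2),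
      (2 ^ n : ℝ) • ((2 ^ m : ℝ) • x - y) - u =
        ((2 ^ (m + n) : ℝ) • x - u) - (2 ^ n : ℝ) • y := by
    intro y u
    rw [smul_sub, smul_smul, ← pow_add, add_comm n m]
    abel
  have hint : Integrable (Function.uncurry fun y u : EuclideanSpace ℝ (Fin 2) =>
      (gaussKernel (((2 ^ (m + n) : ℝ) • x - u) - (2 ^ n : ℝ) • y) (tvar s₀ n) : ℂ) *
        ((gaussKernel y (tvar s₀ m) : ℂ) * p u)) (volume.prod volume) := by
    refine ((integrable_gaussKernel hs).mul_prod hp).bdd_mul (c := (4 * Real.pi * tvar s₀ n)⁻¹)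
      (Continuous.aestronglyMeasurable ?_) (.of_forall fun z => norm_gaussKernel_le ht _)
    exact Complex.continuous_ofReal.comp
      ((continuous_gaussKernel _).comp (by fun_prop))
  calc jump s₀ m (jump s₀ n p) x
      = ∫ y, ∫ u, (gaussKernel (((2 ^ (m + n) : ℝ) • x - u) - (2 ^ n : ℝ) • y) (tvar s₀ n) : ℂ) *
          ((gaussKernel y (tvar s₀ m) : ℂ) * p u) := by
        rw [jump, conv]
        refine integral_congr_ae (.of_forall fun y => ?_)
        simp only [jump, conv_eq_integral_sub, hpoint]
        rw [← integral_const_mul]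
        exact integral_congr_ae (.of_forall fun u => by ring)
    _ = ∫ u, ∫ y, (gaussKernel (((2 ^ (m + n) : ℝ) • x - u) - (2 ^ n : ℝ) • y) (tvar s₀ n) : ℂ) *
          ((gaussKernel y (tvar s₀ m) : ℂ) * p u) := integral_integral_swap hint
    _ = jump s₀ (m + n) p x := by
        rw [jump, conv_eq_integral_sub]
        refine integral_congr_ae (.of_forall fun u => ?_)
        simp only
        rw [tvar_add, ← integral_gaussKernel_mul_gaussKernel hs ht, ← integral_mul_const]
        exact integral_congr_ae (.of_forall fun y => by ring)
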